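/- Let K ⊆ S and define the linear map Res_K : Σ(W) → Σ(W_K) by Res_K(x_I) = Σ_{d ∈ X_{KI}} x^K_{K ∩ dId⁻¹}. Then for all x ∈ Σ(W), x_K · Res_K(x) = x · x_K, and Res_K is a homomorphism of unital Q-algebras. -/

import Mathlib

open MonoidAlgebra

variable {B W : Type*} [DecidableEq B] [Fintype B] [Group W] [Fintype W] [DecidableEq W]

/-- `x_I`: the sum, in the group algebra `ℚW`, of the minimal length coset
representatives of the standard parabolic subgroup `W_I` in `W`, i.e. the sum of the
`w ∈ W` such that `ws > w` for all `s ∈ I`. -/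
noncomputable def descentBasis {M : CoxeterMatrix B} (cs : CoxeterSystem M W)
    (I : Finset B) : MonoidAlgebra ℚ W :=
  ∑ w : W, if ∀ i ∈ I, cs.length w < cs.length (w * cs.simple i)
    then MonoidAlgebra.single w (1 : ℚ) else 0

/-- `A` is the Solomon descent algebra `Σ(W)` of `(W,S)`: a subalgebra of the group
algebra `ℚW` whose underlying set is the span of the elements `x_I`, `I ⊆ S`.
(By Solomon's theorem this span is indeed closed under multiplication.) -/
def IsDescentAlgebra {M : CoxeterMatrix B} (cs : CoxeterSystem M W)
    (A : Subalgebra ℚ (MonoidAlgebra ℚ W)) : Prop :=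
  (A : Set (MonoidAlgebra ℚ W)) = Submodule.span ℚ (Set.range (descentBasis cs))

/-- The standard parabolic subgroup `W_I` generated by the simple reflections in `I`. -/
def parabolic {M : CoxeterMatrix B} (cs : CoxeterSystem M W) (I : Finset B) : Subgroup W :=
  Subgroup.closure (cs.simple '' I)

open scoped Classical in
/-- `x^K_I`: the sum of the elements `w` of the standard parabolic subgroup `W_K` such
that `ws > w` for all `s ∈ I`; for `I ⊆ K` these are the minimal length coset
representatives of `W_I` in `W_K`, and this is the basis element of the descent
algebra `Σ(W_K)` (viewed inside `ℚW`). -/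
noncomputable def parDescentBasis {M : CoxeterMatrix B} (cs : CoxeterSystem M W)
    (K I : Finset B) : MonoidAlgebra ℚ W :=
  ∑ w : W, if w ∈ parabolic cs K ∧ ∀ i ∈ I, cs.length w < cs.length (w * cs.simple i)
    then MonoidAlgebra.single w (1 : ℚ) else 0

/-- `d ∈ X_{KI} = X_K⁻¹ ∩ X_I`. -/
def memXKI {M : CoxeterMatrix B} (cs : CoxeterSystem M W) (K I : Finset B) (d : W) : Prop :=
  (∀ i ∈ K, cs.length d⁻¹ < cs.length (d⁻¹ * cs.simple i)) ∧
    (∀ i ∈ I, cs.length d < cs.length (d * cs.simple i))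

open scoped Classical in
/-- The defining property of the restriction morphism `Res_K : Σ(W) → Σ(W_K)`,
`Res_K(x_I) = Σ_{d ∈ X_{KI}} x^K_{K ∩ dId⁻¹}`, where `R` is a linear extension of it. -/
def IsResK {M : CoxeterMatrix B} (cs : CoxeterSystem M W) (K : Finset B)
    (R : MonoidAlgebra ℚ W →ₗ[ℚ] MonoidAlgebra ℚ W) : Prop :=
  ∀ I : Finset B, R (descentBasis cs I) =
    ∑ d : W, if memXKI cs K I d
      then parDescentBasis cs K
        (K.filter (fun j => ∃ i ∈ I, cs.simple j = d * cs.simple i * d⁻¹))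
      else 0


section CoxeterAux

set_option linter.unusedSectionVars false

/-- The signed conjugation action of a simple reflection. -/
def sgnAct {M : CoxeterMatrix B} (cs : CoxeterSystem M W) (i : B) : Equiv.Perm (W × ZMod 2) :=
  Function.Involutive.toPerm
    (fun p => (cs.simple i * p.1 * cs.simple i, p.2 + if p.1 = cs.simple i then 1 else 0))
    (by
      rintro ⟨t, e⟩
      have h : cs.simple i * t * cs.simple i = cs.simple i ↔ t = cs.simple i := by
        constructor
        · intro h
          have := congrArg (fun x => cs.simple i * x * cs.simple i) h
          simpa [mul_assoc] using this
        · rintro rfl; simp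
      ext
      · simp [mul_assoc]
      · simp only [h, add_assoc]
        split_ifs
        · rw [show (1 + 1 : ZMod 2) = 0 by decide]; simp
        · simp)

lemma sgnAct_apply {M : CoxeterMatrix B} (cs : CoxeterSystem M W) (i : B) (t : W) (e : ZMod 2) :
    sgnAct cs i (t, e) =
      (cs.simple i * t * cs.simple i, e + if t = cs.simple i then 1 else 0) := rfl

lemma sgnAct_pow {M : CoxeterMatrix B} (cs : CoxeterSystem M W) (i j : B) (n : ℕ)
    (t : W) (e : ZMod 2) :
    ((sgnAct cs i * sgnAct cs j) ^ n) (t, e) =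
      ((cs.simple i * cs.simple j) ^ n * t * ((cs.simple i * cs.simple j) ^ n)⁻¹,
        e + ∑ k ∈ Finset.range (2 * n),
          if t = cs.simple j * (cs.simple i * cs.simple j) ^ k then 1 else 0) := by
  induction n with
  | zero => simp
  | succ n ih =>
    rw [pow_succ', Equiv.Perm.mul_apply, ih, Equiv.Perm.mul_apply, sgnAct_apply, sgnAct_apply]
    set a := cs.simple i with ha
    set b := cs.simple j with hb
    have haa : a * a = 1 := by simp [ha]
    have hbb : b * b = 1 := by simp [hb]
    have hai : a⁻¹ = a := by simp [ha]
    have hbi : b⁻¹ = b := by simp [hb]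
    have key : ∀ m : ℕ, ((a * b) ^ m)⁻¹ * b = b * (a * b) ^ m := by
      intro m
      have h1 : b * (a * b) * b⁻¹ = (a * b)⁻¹ := by
        rw [mul_inv_rev, hai, hbi]; simp [mul_assoc, hbb]
      rw [← inv_pow, ← h1, conj_pow, mul_assoc, inv_mul_cancel, mul_one]
    set r := a * b with hr
    have e1 : (r ^ n * t * (r ^ n)⁻¹ = b) ↔ t = b * r ^ (2 * n) := by
      rw [two_mul, pow_add, ← mul_assoc, ← key, mul_inv_eq_iff_eq_mul]
      constructor
      · intro h; rw [mul_assoc, ← h]; group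
      · rintro rfl; group
    have e2 : (b * (r ^ n * t * (r ^ n)⁻¹) * b = a) ↔ t = b * r ^ (2 * n + 1) := by
      have : b * r ^ (2 * n + 1) = (r ^ n)⁻¹ * (b * a * b) * r ^ n := by
        have : b * a * b = b * r := by rw [hr, mul_assoc]
        rw [this, ← mul_assoc, key, show 2 * n + 1 = n + 1 + n by ring, pow_add, pow_add, pow_one]
        simp only [mul_assoc]
      rw [this]
      constructor
      · intro h
        rw [← h]
        have : b * (b * (r ^ n * t * (r ^ n)⁻¹) * b) * b = r ^ n * t * (r ^ n)⁻¹ := by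
          rw [mul_assoc, mul_assoc _ b b, hbb, mul_one, ← mul_assoc, hbb, one_mul]
        rw [this]; group
      · rintro rfl
        have h1 : r ^ n * ((r ^ n)⁻¹ * (b * a * b) * r ^ n) * (r ^ n)⁻¹ = b * a * b := by group
        rw [h1, mul_assoc, mul_assoc (b * a), hbb, mul_one, ← mul_assoc, hbb, one_mul]
    rw [show 2 * (n + 1) = 2 * n + 1 + 1 by ring, Finset.sum_range_succ, Finset.sum_range_succ]
    simp only [e1, e2]
    ext
    · simp only [pow_succ', mul_inv_rev, hr, hai, hbi, mul_assoc]
    · simp only [add_assoc]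

lemma sgnAct_liftable {M : CoxeterMatrix B} (cs : CoxeterSystem M W) :
    M.IsLiftable (sgnAct cs) := by
  intro i j
  ext1 ⟨t, e⟩
  rw [sgnAct_pow, two_mul, Finset.sum_range_add]
  simp only [pow_add, cs.simple_mul_simple_pow, one_mul]
  ext
  · simp
  · simp only [Equiv.Perm.one_apply]
    rw [← two_mul, show (2 : ZMod 2) = 0 by decide]; simp

/-- The signed conjugation action of `W`. -/
noncomputable def sgnHom {M : CoxeterMatrix B} (cs : CoxeterSystem M W) :
    W →* Equiv.Perm (W × ZMod 2) := cs.lift ⟨sgnAct cs, sgnAct_liftable cs⟩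

/-- The inversion cocycle. -/
noncomputable def eta {M : CoxeterMatrix B} (cs : CoxeterSystem M W) (w t : W) : ZMod 2 :=
  (sgnHom cs w (t, 0)).2

lemma sgnHom_apply {M : CoxeterMatrix B} (cs : CoxeterSystem M W) (w : W) :
    ∀ (t : W) (e : ZMod 2), sgnHom cs w (t, e) = (w * t * w⁻¹, e + eta cs w t) := by
  induction w using cs.simple_induction_left with
  | one => intro t e; simp [eta]
  | mul_simple_left w i ih =>
    intro t e
    unfold eta
    simp only [map_mul, Equiv.Perm.mul_apply, ih]
    simp [sgnHom, sgnAct_apply, mul_assoc, add_assoc]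

lemma eta_mul {M : CoxeterMatrix B} (cs : CoxeterSystem M W) (x y t : W) :
    eta cs (x * y) t = eta cs y t + eta cs x (y * t * y⁻¹) := by
  conv_lhs => unfold eta
  rw [map_mul, Equiv.Perm.mul_apply, sgnHom_apply, sgnHom_apply]; simp

lemma eta_one {M : CoxeterMatrix B} (cs : CoxeterSystem M W) (t : W) : eta cs 1 t = 0 := by
  simp [eta]

lemma eta_simple {M : CoxeterMatrix B} (cs : CoxeterSystem M W) (i : B) (t : W) :
    eta cs (cs.simple i) t = if t = cs.simple i then 1 else 0 := by
  simp [eta, sgnHom, sgnAct_apply]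

lemma eta_self {M : CoxeterMatrix B} (cs : CoxeterSystem M W) {t : W} (ht : cs.IsReflection t) :
    eta cs t t = 1 := by
  obtain ⟨u, i, rfl⟩ := ht
  have h := eta_mul cs u u⁻¹ (u * cs.simple i * u⁻¹)
  rw [mul_inv_cancel, eta_one] at h
  rw [eta_mul, eta_mul, eta_simple]
  have e1 : u⁻¹ * (u * cs.simple i * u⁻¹) * u⁻¹⁻¹ = cs.simple i := by group
  rw [e1] at h ⊢
  simp only [CoxeterSystem.simple_mul_simple_self, CoxeterSystem.inv_simple, if_true, one_mul]
  linear_combination -h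

lemma mem_rightInvSeq_of_eta {M : CoxeterMatrix B} (cs : CoxeterSystem M W) (ω : List B) (t : W)
    (h : eta cs (cs.wordProd ω) t ≠ 0) : t ∈ cs.rightInvSeq ω := by
  induction ω with
  | nil => simp [eta_one] at h
  | cons i ω ih =>
    rw [cs.wordProd_cons, eta_mul, eta_simple] at h
    rw [CoxeterSystem.rightInvSeq, List.mem_cons]
    by_cases h1 : eta cs (cs.wordProd ω) t = 0
    · left
      have : cs.wordProd ω * t * (cs.wordProd ω)⁻¹ = cs.simple i := by
        by_contra h2
        simp [h1, h2] at h
      rw [← this]; group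
    · exact Or.inr (ih h1)

lemma zmod2_cases (a : ZMod 2) : a = 0 ∨ a = 1 := by
  revert a; decide

lemma eta_eq_one_iff {M : CoxeterMatrix B} (cs : CoxeterSystem M W) (w : W) {t : W}
    (ht : cs.IsReflection t) : eta cs w t = 1 ↔ cs.length (w * t) < cs.length w := by
  have key : ∀ w : W, eta cs w t = 1 → cs.length (w * t) < cs.length w := by
    intro w h
    obtain ⟨ω, hω, rfl⟩ := cs.exists_isReduced w
    exact (cs.isRightInversion_of_mem_rightInvSeq hω
      (mem_rightInvSeq_of_eta cs ω t (by rw [h]; decide))).2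
  refine ⟨key w, fun h => ?_⟩
  rcases zmod2_cases (eta cs w t) with h0 | h0
  · have := key (w * t) (by
      rw [eta_mul, eta_self cs ht, mul_inv_cancel_right, h0, add_zero])
    rw [mul_assoc, ht.mul_self, mul_one] at this
    omega
  · exact h0

lemma eta_eq_zero_iff {M : CoxeterMatrix B} (cs : CoxeterSystem M W) (w : W) {t : W}
    (ht : cs.IsReflection t) : eta cs w t = 0 ↔ cs.length w < cs.length (w * t) := by
  have h1 := eta_eq_one_iff cs w ht
  have h2 := ht.length_mul_left_ne w
  rcases zmod2_cases (eta cs w t) with h0 | h0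
  · simp only [h0, true_iff]
    have : ¬ cs.length (w * t) < cs.length w := fun h => by
      rw [h1.2 h] at h0; exact absurd h0 (by decide)
    omega
  · have := h1.1 h0
    rw [h0]
    exact ⟨fun h => absurd h (by decide), fun h => by omega⟩

/-- Minimal coset representatives, in terms of the cocycle. -/
lemma minRep_iff {M : CoxeterMatrix B} (cs : CoxeterSystem M W) (I : Finset B) (w : W) :
    (∀ i ∈ I, cs.length w < cs.length (w * cs.simple i)) ↔
      ∀ i ∈ I, eta cs w (cs.simple i) = 0 := by
  simp only [eta_eq_zero_iff cs w (cs.isReflection_simple _)]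

lemma simple_mem_parabolic {M : CoxeterMatrix B} (cs : CoxeterSystem M W) {I : Finset B} {i : B}
    (hi : i ∈ I) : cs.simple i ∈ parabolic cs I :=
  Subgroup.subset_closure ⟨i, hi, rfl⟩

lemma exists_reduced_of_mem {M : CoxeterMatrix B} (cs : CoxeterSystem M W) {I : Finset B} {w : W}
    (hw : w ∈ parabolic cs I) :
    ∃ ω : List B, cs.IsReduced ω ∧ w = cs.wordProd ω ∧ ∀ i ∈ ω, i ∈ I := by
  have step : ∀ (w : W) (i : B), i ∈ I →
      (∃ ω : List B, cs.IsReduced ω ∧ w = cs.wordProd ω ∧ ∀ i ∈ ω, i ∈ I) →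
      (∃ ω : List B, cs.IsReduced ω ∧ w * cs.simple i = cs.wordProd ω ∧ ∀ i ∈ ω, i ∈ I) := by
    rintro w i hi ⟨ω, hω, rfl, hI⟩
    rcases cs.length_mul_simple (cs.wordProd ω) i with h | h
    · refine ⟨ω ++ [i], ?_, ?_, ?_⟩
      · rw [CoxeterSystem.IsReduced, cs.wordProd_append, cs.wordProd_singleton, h, hω.eq]; simp
      · rw [cs.wordProd_append, cs.wordProd_singleton]
      · intro j hj
        rcases List.mem_append.1 hj with h | h
        · exact hI j h
        · rw [List.mem_singleton.1 h]; exact hi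
    · have h1 := (eta_eq_one_iff cs (cs.wordProd ω) (cs.isReflection_simple i)).2 (by omega)
      have h2 := mem_rightInvSeq_of_eta cs ω _ (by rw [h1]; decide)
      obtain ⟨n, hn, h3⟩ := List.getElem_of_mem h2
      have h4 := cs.wordProd_mul_getD_rightInvSeq ω n
      rw [List.getD_eq_getElem _ _ hn, h3] at h4
      refine ⟨ω.eraseIdx n, ?_, h4, fun j hj => hI j (List.mem_of_mem_eraseIdx hj)⟩
      rw [cs.length_rightInvSeq] at hn
      rw [CoxeterSystem.IsReduced, ← h4, List.length_eraseIdx_of_lt hn, ← hω.eq]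
      omega
  unfold parabolic at hw
  induction hw using Subgroup.closure_induction_right with
  | one => exact ⟨[], by simp [CoxeterSystem.IsReduced], by simp, by simp⟩
  | mul_right x hx y hy ih =>
    obtain ⟨i, hi, rfl⟩ := hy
    exact step _ _ hi ih
  | mul_inv_cancel x hx y hy ih =>
    obtain ⟨i, hi, rfl⟩ := hy
    rw [cs.inv_simple]
    exact step _ _ hi ih

lemma eq_one_of_mem {M : CoxeterMatrix B} (cs : CoxeterSystem M W) {I : Finset B} {w : W}
    (hw : w ∈ parabolic cs I) (h : ∀ i ∈ I, eta cs w (cs.simple i) = 0) : w = 1 := by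
  obtain ⟨ω, hω, rfl, hI⟩ := exists_reduced_of_mem cs hw
  rcases List.eq_nil_or_concat ω with rfl | ⟨ω', i, rfl⟩
  · simp
  · exfalso
    have hi : i ∈ I := hI i (by simp)
    have h1 := (eta_eq_zero_iff cs _ (cs.isReflection_simple i)).1 (h i hi)
    rw [hω.eq, cs.wordProd_concat] at h1
    have := cs.length_wordProd_le ω'
    simp [mul_assoc] at h1
    omega

lemma mem_of_eta {M : CoxeterMatrix B} (cs : CoxeterSystem M W) {I : Finset B} {w : W}
    (hw : w ∈ parabolic cs I) : ∀ {t : W}, eta cs w t ≠ 0 → t ∈ parabolic cs I := by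
  obtain ⟨ω, -, rfl, hI⟩ := exists_reduced_of_mem cs hw
  clear hw
  induction ω with
  | nil => intro t h; simp [eta_one] at h
  | cons i ω ih =>
    intro t h
    rw [cs.wordProd_cons, eta_mul, eta_simple] at h
    have ih' := @ih (fun j hj => hI j (List.mem_cons_of_mem _ hj)) t
    have hm : cs.wordProd ω ∈ parabolic cs I := by
      have : ∀ j ∈ ω, j ∈ I := fun j hj => hI j (List.mem_cons_of_mem _ hj)
      clear ih ih' h hI
      induction ω with
      | nil => simp
      | cons k ω ih =>
        rw [cs.wordProd_cons]
        exact Subgroup.mul_mem _ (simple_mem_parabolic cs (this k (by simp)))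
          (ih (fun j hj => this j (List.mem_cons_of_mem _ hj)))
    by_cases h1 : eta cs (cs.wordProd ω) t = 0
    · have h3 : cs.wordProd ω * t * (cs.wordProd ω)⁻¹ = cs.simple i := by
        by_contra h2
        simp [h1, h2] at h
      have : t = (cs.wordProd ω)⁻¹ * cs.simple i * cs.wordProd ω := by rw [← h3]; group
      rw [this]
      exact Subgroup.mul_mem _ (Subgroup.mul_mem _ (Subgroup.inv_mem _ hm)
        (simple_mem_parabolic cs (hI i (by simp)))) hm
    · exact ih' h1

/-- Any coset contains an element on which the cocycle vanishes on `W_I`. -/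
lemma exists_min {M : CoxeterMatrix B} (cs : CoxeterSystem M W) (I : Finset B) (g : W) :
    ∃ u a : W, a ∈ parabolic cs I ∧ g = u * a ∧
      ∀ t ∈ parabolic cs I, cs.IsReflection t → eta cs u t = 0 := by
  let S : Set W := {u | u⁻¹ * g ∈ parabolic cs I}
  have hS : S.Nonempty := ⟨g, by simp [S]⟩
  let u := Function.argminOn cs.length S hS
  have hu : u ∈ S := Function.argminOn_mem cs.length S hS
  refine ⟨u, u⁻¹ * g, hu, by group, fun t ht hr => ?_⟩
  rw [eta_eq_zero_iff cs u hr]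
  have h1 : u * t ∈ S := by
    change (u * t)⁻¹ * g ∈ parabolic cs I
    rw [mul_inv_rev, mul_assoc]
    exact Subgroup.mul_mem _ (Subgroup.inv_mem _ ht) hu
  have h2 : cs.length u ≤ cs.length (u * t) := Function.argminOn_le cs.length S h1
  have h3 := hr.length_mul_left_ne u
  omega

lemma eta_refl_of_min {M : CoxeterMatrix B} (cs : CoxeterSystem M W) {I : Finset B} {u : W}
    (hu : ∀ i ∈ I, eta cs u (cs.simple i) = 0) {t : W} (ht : t ∈ parabolic cs I)
    (hr : cs.IsReflection t) : eta cs u t = 0 := by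
  obtain ⟨v, a, ha, rfl, hv⟩ := exists_min cs I u
  have : a = 1 := by
    refine eq_one_of_mem cs ha (fun i hi => ?_)
    have h := hu i hi
    rw [eta_mul, hv _ _ ((cs.isReflection_simple i).conj a), add_zero] at h
    · exact h
    · exact Subgroup.mul_mem _ (Subgroup.mul_mem _ ha (simple_mem_parabolic cs hi))
        (Subgroup.inv_mem _ ha)
  subst this
  rw [mul_one]; exact hv t ht hr

lemma eta_mul_min {M : CoxeterMatrix B} (cs : CoxeterSystem M W) {I : Finset B} {u a : W}
    (hu : ∀ i ∈ I, eta cs u (cs.simple i) = 0) (ha : a ∈ parabolic cs I) {i : B} (hi : i ∈ I) :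
    eta cs (u * a) (cs.simple i) = eta cs a (cs.simple i) := by
  rw [eta_mul, eta_refl_of_min cs hu _ ((cs.isReflection_simple i).conj a), add_zero]
  exact Subgroup.mul_mem _ (Subgroup.mul_mem _ ha (simple_mem_parabolic cs hi))
    (Subgroup.inv_mem _ ha)

lemma exists_decomp {M : CoxeterMatrix B} (cs : CoxeterSystem M W) (I : Finset B) (g : W) :
    ∃ u : W, u⁻¹ * g ∈ parabolic cs I ∧ ∀ i ∈ I, eta cs u (cs.simple i) = 0 := by
  obtain ⟨u, a, ha, rfl, h⟩ := exists_min cs I g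
  exact ⟨u, by simpa using ha,
    fun i hi => h _ (simple_mem_parabolic cs hi) (cs.isReflection_simple i)⟩

lemma decomp_unique {M : CoxeterMatrix B} (cs : CoxeterSystem M W) {I : Finset B} {u v : W}
    (hu : ∀ i ∈ I, eta cs u (cs.simple i) = 0) (hv : ∀ i ∈ I, eta cs v (cs.simple i) = 0)
    (h : u⁻¹ * v ∈ parabolic cs I) : u = v := by
  have : u⁻¹ * v = 1 := by
    refine eq_one_of_mem cs h (fun i hi => ?_)
    rw [← eta_mul_min cs hu h hi, mul_inv_cancel_left]; exact hv i hi
  exact inv_mul_eq_one.1 this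

/-- Deodhar's lemma, in the form used here. -/
lemma conj_simple {M : CoxeterMatrix B} (cs : CoxeterSystem M W) {I : Finset B} {e : W}
    (he : ∀ i ∈ I, eta cs e (cs.simple i) = 0) {j : B}
    (h : e⁻¹ * cs.simple j * e ∈ parabolic cs I) :
    ∃ i ∈ I, cs.simple j = e * cs.simple i * e⁻¹ := by
  by_contra hne
  push Not at hne
  have : e⁻¹ * cs.simple j * e = 1 := by
    refine eq_one_of_mem cs h (fun i hi => ?_)
    rw [← eta_mul_min cs he h hi, show e * (e⁻¹ * cs.simple j * e) = cs.simple j * e by group,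
      eta_mul, he i hi, eta_simple, if_neg (fun h => hne i hi h.symm), add_zero]
  have h2 : cs.simple j = 1 := by
    have h3 : cs.simple j = e * (e⁻¹ * cs.simple j * e) * e⁻¹ := by group
    rw [h3, this]; simp
  have := cs.length_simple j
  rw [h2, cs.length_one] at this
  omega

lemma mul_inv_min_iff {M : CoxeterMatrix B} (cs : CoxeterSystem M W) {K I : Finset B} {e w u : W}
    (he : ∀ i ∈ I, eta cs e (cs.simple i) = 0) (he' : ∀ j ∈ K, eta cs e⁻¹ (cs.simple j) = 0)
    (hu : ∀ i ∈ I, eta cs u (cs.simple i) = 0) (ha : u⁻¹ * (w * e) ∈ parabolic cs I) :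
    (∀ j ∈ K, eta cs (u⁻¹ * w) (cs.simple j) = 0) ↔
      ∀ j ∈ K, (∃ i ∈ I, cs.simple j = e * cs.simple i * e⁻¹) → eta cs w (cs.simple j) = 0 := by
  refine forall₂_congr (fun j hj => ?_)
  have h1 : eta cs (u⁻¹ * w) (cs.simple j) =
      eta cs (u⁻¹ * (w * e)) (e⁻¹ * cs.simple j * e) := by
    rw [show u⁻¹ * w = u⁻¹ * (w * e) * e⁻¹ by group, eta_mul, he' j hj, zero_add, inv_inv]
  rw [h1]
  by_cases hex : ∃ i ∈ I, cs.simple j = e * cs.simple i * e⁻¹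
  · simp only [hex, true_imp_iff]
    obtain ⟨i, hi, h⟩ := hex
    rw [show e⁻¹ * cs.simple j * e = cs.simple i by rw [h]; group,
      ← eta_mul_min cs hu ha hi, mul_inv_cancel_left, eta_mul, he i hi, zero_add, ← h]
  · simp only [hex, false_imp_iff, iff_true]
    by_contra h2
    exact hex (conj_simple cs he (mem_of_eta cs ha h2))

lemma min_of_mul {M : CoxeterMatrix B} (cs : CoxeterSystem M W) {K I : Finset B} {e v : W}
    (he : ∀ i ∈ I, eta cs e (cs.simple i) = 0) (hv : ∀ j ∈ K, eta cs v (cs.simple j) = 0)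
    (ha : v * e ∈ parabolic cs I) : ∀ j ∈ K, eta cs e⁻¹ (cs.simple j) = 0 := by
  intro j hj
  by_contra h
  have h1 := hv j hj
  rw [show v = (v * e) * e⁻¹ by group, eta_mul, inv_inv] at h1
  have h2 : eta cs (v * e) (e⁻¹ * cs.simple j * e) ≠ 0 := fun h2 => by
    rw [h2, add_zero] at h1; exact h h1
  have hr : cs.IsReflection (e⁻¹ * cs.simple j * e) := by
    simpa using (cs.isReflection_simple j).conj e⁻¹
  have h3 := eta_refl_of_min cs he (mem_of_eta cs ha h2) hr
  rw [eta_eq_zero_iff cs e hr, show e * (e⁻¹ * cs.simple j * e) = cs.simple j * e by group] at h3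
  rw [eta_eq_zero_iff cs _ (cs.isReflection_simple j), ← cs.length_inv (e⁻¹ * cs.simple j)] at h
  simp at h
  omega

end CoxeterAux

section AlgebraAux

set_option linter.unusedSectionVars false

open scoped Classical in
/-- The sum in the group algebra of the elements satisfying a predicate. -/
noncomputable def indSum (P : W → Prop) : MonoidAlgebra ℚ W :=
  ∑ w : W, if P w then MonoidAlgebra.single w (1 : ℚ) else 0

open scoped Classical in
lemma coeff_indSum (P : W → Prop) (w : W) :
    (indSum P).coeff w = if P w then 1 else 0 := by
  unfold indSum
  rw [MonoidAlgebra.coeff_sum, Finsupp.finsetSum_apply, Finset.sum_eq_single w]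
  · split_ifs <;> simp
  · intro v _ hv
    split_ifs <;> simp [hv]
  · simp

lemma coeff_mul_sum (x y : MonoidAlgebra ℚ W) (w : W) :
    (x * y).coeff w = ∑ v : W, x.coeff (w * v⁻¹) * y.coeff v := by
  rw [MonoidAlgebra.coeff_mul, Finsupp.sum_fintype _ _ (by simp)]
  have : ∀ i : W, (y.coeff.sum fun a b => if i * a = w then x.coeff i * b else 0) =
      ∑ a : W, if i * a = w then x.coeff i * y.coeff a else 0 := by
    intro i
    rw [Finsupp.sum_fintype _ _ (by simp)]
  simp only [this]
  rw [Finset.sum_comm]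
  refine Finset.sum_congr rfl (fun v _ => ?_)
  simp only [← eq_mul_inv_iff_mul_eq]
  simp

open scoped Classical in
lemma coeff_indSum_mul (P Q : W → Prop) (w : W) :
    (indSum P * indSum Q).coeff w =
      ((Finset.univ.filter (fun v => P (w * v⁻¹) ∧ Q v)).card : ℚ) := by
  rw [coeff_mul_sum]
  simp only [coeff_indSum]
  rw [Finset.card_filter]
  push_cast
  refine Finset.sum_congr rfl (fun v _ => ?_)
  by_cases h1 : P (w * v⁻¹) <;> by_cases h2 : Q v <;> simp [h1, h2]

open scoped Classical in
lemma coeff_sum_indSum (D : W → Prop) (Q : W → W → Prop) (w : W) :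
    (∑ d : W, if D d then indSum (Q d) else 0).coeff w =
      ((Finset.univ.filter (fun d => D d ∧ Q d w)).card : ℚ) := by
  rw [MonoidAlgebra.coeff_sum, Finsupp.finsetSum_apply, Finset.card_filter]
  push_cast
  refine Finset.sum_congr rfl (fun v _ => ?_)
  by_cases h1 : D v <;> by_cases h2 : Q v w <;> simp [h1, h2, coeff_indSum]

lemma descentBasis_eq {M : CoxeterMatrix B} (cs : CoxeterSystem M W) (I : Finset B) :
    descentBasis cs I = indSum (fun w => ∀ i ∈ I, eta cs w (cs.simple i) = 0) := by
  unfold descentBasis indSum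
  refine Finset.sum_congr rfl (fun w _ => ?_)
  have := minRep_iff cs I w
  split_ifs <;> tauto

lemma parDescentBasis_eq {M : CoxeterMatrix B} (cs : CoxeterSystem M W) (K I : Finset B) :
    parDescentBasis cs K I =
      indSum (fun w => w ∈ parabolic cs K ∧ ∀ i ∈ I, eta cs w (cs.simple i) = 0) := by
  unfold parDescentBasis indSum
  refine Finset.sum_congr rfl (fun w _ => ?_)
  have := minRep_iff cs I w
  split_ifs <;> tauto

/-- `x_K x^K_J = x_J`. -/
lemma descent_mul_par {M : CoxeterMatrix B} (cs : CoxeterSystem M W) {K J : Finset B}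
    (hJ : J ⊆ K) : descentBasis cs K * parDescentBasis cs K J = descentBasis cs J := by
  classical
  rw [descentBasis_eq, descentBasis_eq, parDescentBasis_eq]
  ext w
  rw [coeff_indSum_mul, coeff_indSum]
  obtain ⟨u, ha, hu⟩ := exists_decomp cs K w
  have huniq : ∀ v : W, (∀ i ∈ K, eta cs (w * v⁻¹) (cs.simple i) = 0) →
      v ∈ parabolic cs K → v = u⁻¹ * w := by
    intro v h1 h2
    have : u = w * v⁻¹ := decomp_unique cs hu h1 (by
      rw [← mul_assoc]; exact Subgroup.mul_mem _ ha (Subgroup.inv_mem _ h2))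
    rw [this]; group
  have heq : ∀ i ∈ J, eta cs (u⁻¹ * w) (cs.simple i) = eta cs w (cs.simple i) := by
    intro i hi
    rw [← eta_mul_min cs hu ha (hJ hi), mul_inv_cancel_left]
  split_ifs with hw
  · rw [Nat.cast_eq_one, Finset.card_eq_one]
    refine ⟨u⁻¹ * w, ?_⟩
    · ext v
      simp only [Finset.mem_filter, Finset.mem_univ, true_and, Finset.mem_singleton]
      constructor
      · rintro ⟨h1, h2, -⟩; exact huniq v h1 h2
      · rintro rfl
        refine ⟨?_, ha, fun i hi => (heq i hi).trans (hw i hi)⟩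
        rw [show w * (u⁻¹ * w)⁻¹ = u by group]; exact hu
  · rw [Nat.cast_eq_zero, Finset.card_eq_zero, Finset.eq_empty_iff_forall_notMem]
    intro v hv
    simp only [Finset.mem_filter, Finset.mem_univ, true_and] at hv
    obtain ⟨h1, h2, h3⟩ := hv
    obtain rfl := huniq v h1 h2
    exact hw (fun i hi => (heq i hi).symm.trans (h3 i hi))

open scoped Classical in
/-- Solomon's formula. -/
lemma solomon {M : CoxeterMatrix B} (cs : CoxeterSystem M W) (K I : Finset B) :
    descentBasis cs I * descentBasis cs K =
      ∑ d : W, if memXKI cs K I d then descentBasis cs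
        (K.filter (fun j => ∃ i ∈ I, cs.simple j = d * cs.simple i * d⁻¹)) else 0 := by
  have hX : ∀ d, memXKI cs K I d ↔ (∀ j ∈ K, eta cs d⁻¹ (cs.simple j) = 0) ∧
      (∀ i ∈ I, eta cs d (cs.simple i) = 0) := by
    intro d; unfold memXKI; rw [minRep_iff, minRep_iff]
  simp only [descentBasis_eq]
  ext w
  rw [coeff_indSum_mul, coeff_sum_indSum]
  norm_cast
  choose p hp1 hp2 using exists_decomp cs I
  refine Finset.card_bij' (fun v _ => p v⁻¹) (fun e _ => (p (w * e))⁻¹ * w) ?_ ?_ ?_ ?_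
  · intro v hv
    simp only [Finset.mem_filter, Finset.mem_univ, true_and] at hv ⊢
    obtain ⟨h1, h2⟩ := hv
    have hve : v * p v⁻¹ ∈ parabolic cs I := by
      have := Subgroup.inv_mem _ (hp1 v⁻¹)
      simpa using this
    have he' := min_of_mul cs (hp2 v⁻¹) h2 hve
    refine ⟨(hX _).2 ⟨he', hp2 _⟩, ?_⟩
    have h3 := (mul_inv_min_iff cs (w := w) (u := w * v⁻¹) (hp2 v⁻¹) he' h1
      (by rw [show (w * v⁻¹)⁻¹ * (w * p v⁻¹) = v * p v⁻¹ by group]; exact hve)).1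
      (by rw [show (w * v⁻¹)⁻¹ * w = v by group]; exact h2)
    intro j hj
    exact h3 j hj.1 hj.2
  · intro e he
    simp only [Finset.mem_filter, Finset.mem_univ, true_and] at he ⊢
    obtain ⟨h1, h2⟩ := he
    obtain ⟨h3, h4⟩ := (hX e).1 h1
    refine ⟨?_, ?_⟩
    · rw [show w * ((p (w * e))⁻¹ * w)⁻¹ = p (w * e) by group]; exact hp2 _
    · refine (mul_inv_min_iff cs h4 h3 (hp2 _) (hp1 _)).2 (fun j hj hex => h2 j ?_)
      exact ⟨hj, hex⟩
  · intro v hv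
    simp only [Finset.mem_filter, Finset.mem_univ, true_and] at hv
    have : p (w * p v⁻¹) = w * v⁻¹ := by
      refine decomp_unique cs (hp2 _) hv.1 ?_
      have := Subgroup.mul_mem _ (hp1 (w * p v⁻¹)) (hp1 v⁻¹)
      convert this using 1
      group
    simp only [this]; group
  · intro e he
    simp only [Finset.mem_filter, Finset.mem_univ, true_and] at he
    obtain ⟨h3, h4⟩ := (hX e).1 he.1
    refine decomp_unique cs (hp2 _) h4 ?_
    convert! Subgroup.mul_mem _ (hp1 (((p (w * e))⁻¹ * w)⁻¹)) (hp1 (w * e)) using 1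
    group

/-- Elements of the group algebra supported on `W_K`. -/
def SuppOn {M : CoxeterMatrix B} (cs : CoxeterSystem M W) (K : Finset B)
    (a : MonoidAlgebra ℚ W) : Prop := ∀ w, w ∉ parabolic cs K → a.coeff w = 0

lemma SuppOn.mul {M : CoxeterMatrix B} {cs : CoxeterSystem M W} {K : Finset B}
    {a b : MonoidAlgebra ℚ W} (ha : SuppOn cs K a) (hb : SuppOn cs K b) :
    SuppOn cs K (a * b) := by
  intro w hw
  rw [coeff_mul_sum]
  refine Finset.sum_eq_zero (fun v _ => ?_)
  by_cases hv : v ∈ parabolic cs K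
  · rw [ha, zero_mul]
    intro h
    exact hw (by simpa using Subgroup.mul_mem _ h hv)
  · rw [hb v hv, mul_zero]

lemma coeff_descent_mul {M : CoxeterMatrix B} (cs : CoxeterSystem M W) {K : Finset B}
    {a : MonoidAlgebra ℚ W} (ha : SuppOn cs K a) {w : W} (hw : w ∈ parabolic cs K) :
    (descentBasis cs K * a).coeff w = a.coeff w := by
  classical
  rw [coeff_mul_sum, Finset.sum_eq_single w]
  · rw [descentBasis_eq, coeff_indSum, if_pos, one_mul]
    intro i _; rw [mul_inv_cancel, eta_one]
  · intro v _ hv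
    by_cases hvK : v ∈ parabolic cs K
    · rw [descentBasis_eq, coeff_indSum, if_neg, zero_mul]
      intro h
      have := eq_one_of_mem cs (Subgroup.mul_mem _ hw (Subgroup.inv_mem _ hvK)) h
      exact hv (mul_inv_eq_one.1 this).symm
    · rw [ha v hvK, mul_zero]
  · simp

lemma descent_mul_inj {M : CoxeterMatrix B} (cs : CoxeterSystem M W) {K : Finset B}
    {a b : MonoidAlgebra ℚ W} (ha : SuppOn cs K a) (hb : SuppOn cs K b)
    (h : descentBasis cs K * a = descentBasis cs K * b) : a = b := by
  ext w
  by_cases hw : w ∈ parabolic cs K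
  · rw [← coeff_descent_mul cs ha hw, h, coeff_descent_mul cs hb hw]
  · rw [ha w hw, hb w hw]

/-- Sub-ℚ-module of elements supported on `W_K`. -/
def suppSubmodule {M : CoxeterMatrix B} (cs : CoxeterSystem M W) (K : Finset B) :
    Submodule ℚ (MonoidAlgebra ℚ W) where
  carrier := {a | SuppOn cs K a}
  add_mem' := by
    intro a b ha hb w hw
    simp [ha w hw, hb w hw]
  zero_mem' := by intro w _; simp
  smul_mem' := by
    intro c a ha w hw
    simp [ha w hw]

lemma suppOn_par {M : CoxeterMatrix B} (cs : CoxeterSystem M W) (K J : Finset B) :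
    parDescentBasis cs K J ∈ suppSubmodule cs K := by
  classical
  intro w hw
  rw [parDescentBasis_eq, coeff_indSum, if_neg (fun h => hw h.1)]

lemma suppOn_res {M : CoxeterMatrix B} (cs : CoxeterSystem M W) (K : Finset B)
    (R : MonoidAlgebra ℚ W →ₗ[ℚ] MonoidAlgebra ℚ W) (hR : IsResK cs K R)
    {x : MonoidAlgebra ℚ W} (hx : x ∈ Submodule.span ℚ (Set.range (descentBasis cs))) :
    SuppOn cs K (R x) := by
  have : Submodule.span ℚ (Set.range (descentBasis cs)) ≤ (suppSubmodule cs K).comap R := by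
    rw [Submodule.span_le]
    rintro _ ⟨I, rfl⟩
    change R _ ∈ suppSubmodule cs K
    rw [hR I]
    refine Submodule.sum_mem _ (fun d _ => ?_)
    split_ifs
    · exact suppOn_par cs K _
    · exact Submodule.zero_mem _
  exact this hx

lemma descent_mul_res {M : CoxeterMatrix B} (cs : CoxeterSystem M W) (K : Finset B)
    (R : MonoidAlgebra ℚ W →ₗ[ℚ] MonoidAlgebra ℚ W) (hR : IsResK cs K R)
    {x : MonoidAlgebra ℚ W} (hx : x ∈ Submodule.span ℚ (Set.range (descentBasis cs))) :
    descentBasis cs K * R x = x * descentBasis cs K := by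
  induction hx using Submodule.span_induction with
  | mem x h =>
    obtain ⟨I, rfl⟩ := h
    rw [hR I, solomon, Finset.mul_sum]
    refine Finset.sum_congr rfl (fun d _ => ?_)
    split_ifs
    · exact descent_mul_par cs (Finset.filter_subset _ _)
    · exact mul_zero _
  | zero => simp
  | add x y _ _ hx hy => rw [map_add, mul_add, add_mul, hx, hy]
  | smul c x _ hx => rw [map_smul, mul_smul_comm, smul_mul_assoc, hx]

lemma suppOn_one {M : CoxeterMatrix B} (cs : CoxeterSystem M W) (K : Finset B) :
    SuppOn cs K 1 := by
  intro w hw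
  have : w ≠ 1 := fun h => hw (h ▸ Subgroup.one_mem _)
  simp [MonoidAlgebra.one_def, this]

end AlgebraAux

set_option synthInstance.maxHeartbeats 1000000 in
set_option maxHeartbeats 1000000 in
/-- The restriction map `Res_K : Σ(W) → Σ(W_K)`, defined on the basis by
`Res_K(x_I) = Σ_{d ∈ X_{KI}} x^K_{K ∩ dId⁻¹}`, satisfies
`x_K · Res_K(x) = x · x_K` for all `x ∈ Σ(W)`, and is a homomorphism of unital
`ℚ`-algebras. -/
theorem resK_is_algHom {M : CoxeterMatrix B}
    (cs : CoxeterSystem M W) (A : Subalgebra ℚ (MonoidAlgebra ℚ W))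
    (hA : IsDescentAlgebra cs A) (K : Finset B)
    (R : MonoidAlgebra ℚ W →ₗ[ℚ] MonoidAlgebra ℚ W) (hR : IsResK cs K R) :
    (∀ x ∈ A, descentBasis cs K * R x = x * descentBasis cs K) ∧
    R 1 = 1 ∧ (∀ x ∈ A, ∀ y ∈ A, R (x * y) = R x * R y) := by
  have hmem : ∀ x, x ∈ A ↔ x ∈ Submodule.span ℚ (Set.range (descentBasis cs)) := by
    intro x
    rw [← SetLike.mem_coe, hA, SetLike.mem_coe]
  have h1 : ∀ x ∈ A, descentBasis cs K * R x = x * descentBasis cs K :=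
    fun x hx => descent_mul_res cs K R hR ((hmem x).1 hx)
  have hs : ∀ x ∈ A, SuppOn cs K (R x) := fun x hx => suppOn_res cs K R hR ((hmem x).1 hx)
  refine ⟨h1, ?_, fun x hx y hy => ?_⟩
  · refine descent_mul_inj cs (hs 1 A.one_mem) (suppOn_one cs K) ?_
    rw [h1 1 A.one_mem, one_mul, mul_one]
  · refine descent_mul_inj cs (hs _ (A.mul_mem hx hy)) ((hs x hx).mul (hs y hy)) ?_
    rw [h1 _ (A.mul_mem hx hy), ← mul_assoc, h1 x hx, mul_assoc, mul_assoc, h1 y hy]
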